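/- Let P ⊂ ℝ^d be a lattice polytope. Then the following are equivalent: (i) P is centrally symmetric; (ii) for every c ∈ ℚ^d, the Ehrhart quasi-polynomial L_{c+P}(t) = #(t(c+P) ∩ ℤ^d) is symmetric with respect to the period den(c). -/

import Mathlib

open Pointwise MeasureTheory
open scoped RealInnerProductSpace

noncomputable section

/-- Cast an integer vector to a real vector. -/
def castVec {d : ℕ} (x : Fin d → ℤ) : Fin d → ℝ := fun i => (x i : ℝ)

/-- Cast a rational vector to a real vector. -/
def ratVec {d : ℕ} (c : Fin d → ℚ) : Fin d → ℝ := fun i => (c i : ℝ)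

/-- `den(c)`: the lcm of the denominators of the coordinates of a rational vector. -/
def denv {d : ℕ} (c : Fin d → ℚ) : ℕ := Finset.univ.lcm fun i => (c i).den

/-- The number of lattice points in a subset of `ℝ^d`. -/
def latCount {d : ℕ} (S : Set (Fin d → ℝ)) : ℕ := {x : Fin d → ℤ | castVec x ∈ S}.ncard

/-- A lattice polytope: the convex hull of a nonempty finite set of integer points. -/
def IsLatticePolytope {d : ℕ} (P : Set (Fin d → ℝ)) : Prop :=
  ∃ V : Finset (Fin d → ℤ), V.Nonempty ∧ P = convexHull ℝ (castVec '' (V : Set (Fin d → ℤ)))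

/-- The zonotope spanned by a finite set of integer vectors. -/
def zonotopeF {d : ℕ} (U : Finset (Fin d → ℤ)) : Set (Fin d → ℝ) :=
  {x | ∃ lam : (Fin d → ℤ) → ℝ, (∀ u, lam u ∈ Set.Icc (0 : ℝ) 1) ∧
    x = ∑ u ∈ U, lam u • castVec u}

/-- The zonotope spanned by integer vectors `u 0, …, u (n-1)`. -/
def zonotopeZ {d n : ℕ} (u : Fin n → Fin d → ℤ) : Set (Fin d → ℝ) :=
  {x | ∃ lam : Fin n → ℝ, (∀ i, lam i ∈ Set.Icc (0 : ℝ) 1) ∧ x = ∑ i, lam i • castVec (u i)}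

/-- The zonotope spanned by real vectors `u 0, …, u (n-1)`. -/
def zonotopeR {d n : ℕ} (u : Fin n → Fin d → ℝ) : Set (Fin d → ℝ) :=
  {x | ∃ lam : Fin n → ℝ, (∀ i, lam i ∈ Set.Icc (0 : ℝ) 1) ∧ x = ∑ i, lam i • u i}

/-- A zonotope: a translate of the Minkowski sum of finitely many segments `[0, uᵢ]`. -/
def IsZonotope {d : ℕ} (P : Set (Fin d → ℝ)) : Prop :=
  ∃ (n : ℕ) (u : Fin n → Fin d → ℝ) (v : Fin d → ℝ), P = v +ᵥ zonotopeR u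

/-- A set is centrally symmetric if it is a translate of its negation. -/
def CentrallySymmetric {d : ℕ} (P : Set (Fin d → ℝ)) : Prop :=
  ∃ v : Fin d → ℝ, P = v +ᵥ (-P)

/-- `f` is a family of constituents of `L` with respect to the period `ρ`. -/
def IsConstituents (L : ℕ → ℚ) (ρ : ℕ) (f : ℕ → Polynomial ℚ) : Prop :=
  ∀ t : ℕ, 0 < t → L t = (f (t % ρ)).eval (t : ℚ)

/-- `ρ` is a period of the quasi-polynomial `L`. -/
def IsPeriodOf (ρ : ℕ) (L : ℕ → ℚ) : Prop := 0 < ρ ∧ ∃ f, IsConstituents L ρ f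

/-- `ρ₀` is the minimal period of the quasi-polynomial `L`. -/
def IsMinimalPeriodOf (ρ₀ : ℕ) (L : ℕ → ℚ) : Prop :=
  IsPeriodOf ρ₀ L ∧ ∀ ρ : ℕ, IsPeriodOf ρ L → ρ₀ ≤ ρ

/-- GCD-property with respect to the period `ρ`: constituents with equal
`gcd(ρ, ·)` coincide. -/
def GCDProperty (L : ℕ → ℚ) (ρ : ℕ) : Prop :=
  ∀ f : ℕ → Polynomial ℚ, IsConstituents L ρ f →
    ∀ k ℓ : ℕ, Nat.gcd ρ k = Nat.gcd ρ ℓ → f (k % ρ) = f (ℓ % ρ)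

/-- Symmetry with respect to the period `ρ`: `f_k = f_{ρ-k}` for `0 ≤ k ≤ ρ`. -/
def SymmetricQP (L : ℕ → ℚ) (ρ : ℕ) : Prop :=
  ∀ f : ℕ → Polynomial ℚ, IsConstituents L ρ f →
    ∀ k : ℕ, k ≤ ρ → f (k % ρ) = f ((ρ - k) % ρ)

/-- The Ehrhart counting function `t ↦ #(t(c + P) ∩ ℤ^d)` of the translate `c + P`. -/
def ehr {d : ℕ} (P : Set (Fin d → ℝ)) (c : Fin d → ℚ) : ℕ → ℚ :=
  fun t => (latCount ((t : ℝ) • (ratVec c +ᵥ P)) : ℚ)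

/-- The dimension of a polytope: the dimension of the direction of its affine hull. -/
def polyDim {d : ℕ} (P : Set (Fin d → ℝ)) : ℕ := Module.finrank ℝ (affineSpan ℝ P).direction

/-- `r` is the relative volume of `P` (of dimension `m`): with respect to any lattice
point `v₀` of `P` and any `ℤ`-basis `b` of the lattice `aff₀(P) ∩ ℤ^d`, `r` is the
Lebesgue measure of `P` in the coordinates determined by `v₀` and `b`. -/
def IsRelVolOf {d : ℕ} (P : Set (Fin d → ℝ)) (m : ℕ) (r : ℝ) : Prop :=
  ∀ (v₀ : Fin d → ℤ) (b : Fin m → Fin d → ℤ),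
    castVec v₀ ∈ P → LinearIndependent ℤ b →
    (∀ x : Fin d → ℤ,
      castVec x ∈ (affineSpan ℝ P).direction ↔ x ∈ Submodule.span ℤ (Set.range b)) →
    r = (volume {lam : Fin m → ℝ | castVec v₀ + ∑ i, lam i • castVec (b i) ∈ P}).toReal

/-- The (real casts of the) elements of `W` are linearly independent over `ℝ`. -/
def LinIndepF {d : ℕ} (W : Finset (Fin d → ℤ)) : Prop :=
  LinearIndependent ℝ fun w : ↥W => castVec w.1

/-- Almost locally constant: locally constant outside a discrete point set. -/
def AlmostLocallyConstant (f : ℝ → ℝ) : Prop :=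
  ∃ D : Set ℝ, DiscreteTopology D ∧ IsLocallyConstant fun x : ↥(Dᶜ) => f ↑x

/-- Almost constant: constant outside a discrete point set. -/
def AlmostConstant (f : ℝ → ℝ) : Prop :=
  ∃ D : Set ℝ, DiscreteTopology D ∧ ∃ r : ℝ, ∀ x ∉ D, f x = r

/-- The face of `P` in the outer normal direction `v`. -/
def normalFace {d : ℕ} (P : Set (EuclideanSpace ℝ (Fin d)))
    (v : EuclideanSpace ℝ (Fin d)) : Set (EuclideanSpace ℝ (Fin d)) :=
  {x | x ∈ P ∧ ∀ y ∈ P, ⟪y, v⟫ ≤ ⟪x, v⟫}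

/-- `F` is a facet of the `d`-polytope `P`: an exposed face of dimension `d - 1`. -/
def IsFacetOf {d : ℕ} (F P : Set (EuclideanSpace ℝ (Fin d))) : Prop :=
  (∃ v : EuclideanSpace ℝ (Fin d), v ≠ 0 ∧ F = normalFace P v) ∧
  Module.finrank ℝ (affineSpan ℝ F).direction = d - 1

theorem sum_nonempty_eq_zero_of_compact_intervals {ι : Type*} (s : Finset ι) (a : ι → ℤ)
    (I : ι → Set ℝ) (hI : ∀ i, IsCompact (I i)) (hconv : ∀ i, Convex ℝ (I i))
    (h : ∀ x, ∑ i ∈ s, (I i).indicator (fun _ => a i) x = 0) :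
    ∑ i ∈ s, (I i).indicator (fun _ => a i) (sSup (I i)) = 0 := by
  classical
  have hmem : ∀ i x, x ∈ I i → sSup (I i) ∈ I i := fun i x hx => (hI i).sSup_mem ⟨x, hx⟩
  have hle : ∀ i x, x ∈ I i → x ≤ sSup (I i) := fun i x hx => le_csSup (hI i).bddAbove hx
  have key : ∀ x, ∑ i ∈ s with sSup (I i) = x, (I i).indicator (fun _ => a i) x = 0 := by
    intro x
    have hev : ∀ᶠ y in nhdsWithin x (Set.Ioi x), ∀ i ∈ s,
        (I i).indicator (fun _ => a i) y =
          if sSup (I i) = x then 0 else (I i).indicator (fun _ => a i) x := by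
      rw [Filter.eventually_all_finset]
      intro i _
      by_cases hx : x ∈ I i
      · by_cases hs : sSup (I i) = x
        · filter_upwards [self_mem_nhdsWithin] with y hy
          rw [if_pos hs, Set.indicator_of_notMem]
          intro hyI
          exact absurd (hle i y hyI) (by rw [hs]; exact not_le.2 hy)
        · have hlt : x < sSup (I i) := lt_of_le_of_ne (hle i x hx) (Ne.symm hs)
          filter_upwards [Ioo_mem_nhdsGT hlt] with y hy
          rw [if_neg hs, Set.indicator_of_mem hx, Set.indicator_of_mem]
          exact (hconv i).ordConnected.out hx (hmem i x hx) ⟨hy.1.le, hy.2.le⟩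
      · have : (I i)ᶜ ∈ nhds x := (hI i).isClosed.isOpen_compl.mem_nhds hx
        filter_upwards [mem_nhdsWithin_of_mem_nhds this] with y hy
        rw [Set.indicator_of_notMem hx, Set.indicator_of_notMem hy, ite_self]
    obtain ⟨y, hy⟩ := hev.exists
    have h1 := h y
    rw [Finset.sum_congr rfl hy] at h1
    have h2 := h x
    rw [Finset.sum_ite, Finset.sum_const_zero, zero_add] at h1
    rw [← Finset.sum_filter_add_sum_filter_not s (fun i => sSup (I i) = x), h1, add_zero] at h2
    exact h2
  rw [← Finset.sum_fiberwise_of_maps_to (t := s.image fun i => sSup (I i))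
    (fun i hi => Finset.mem_image_of_mem _ hi)]
  refine Finset.sum_eq_zero fun x _ => ?_
  rw [← key x]
  refine Finset.sum_congr rfl fun i hi => ?_
  rw [(Finset.mem_filter.1 hi).2]

open Classical in
/-- The Euler characteristic, which is `1` on nonempty compact convex sets, respects linear
relations between indicator functions. -/
theorem sum_nonempty_eq_zero_of_sum_indicator_eq_zero {n : ℕ} {ι : Type*} (s : Finset ι)
    (a : ι → ℤ) (K : ι → Set (Fin n → ℝ)) (hK : ∀ i, IsCompact (K i))
    (hconv : ∀ i, Convex ℝ (K i))
    (h : ∀ x, ∑ i ∈ s, (if x ∈ K i then a i else 0) = 0) :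
    ∑ i ∈ s, (if (K i).Nonempty then a i else 0) = 0 := by
  induction n with
  | zero =>
    refine (Finset.sum_congr rfl fun i _ => ?_).trans (h 0)
    have : (K i).Nonempty ↔ 0 ∈ K i :=
      ⟨fun ⟨x, hx⟩ => by rwa [Subsingleton.elim 0 x], fun h => ⟨0, h⟩⟩
    simp only [this]
  | succ n ih =>
    set I : ι → Set ℝ := fun i => (fun x : Fin (n + 1) → ℝ => x 0) '' K i with hI
    have hIc : ∀ i, IsCompact (I i) := fun i => (hK i).image (continuous_apply 0)
    have hIconv : ∀ i, Convex ℝ (I i) := fun i =>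
      (hconv i).linear_image (LinearMap.proj 0 : (Fin (n + 1) → ℝ) →ₗ[ℝ] ℝ)
    have hsum : ∀ t, ∑ i ∈ s, (I i).indicator (fun _ => a i) t = 0 := by
      intro t
      have hcont : Continuous fun y : Fin n → ℝ => (Fin.cons t y : Fin (n + 1) → ℝ) := by
        fun_prop
      have := ih (fun i => (fun y : Fin n → ℝ => (Fin.cons t y : Fin (n + 1) → ℝ)) ⁻¹' K i)
        (fun i => ?_) (fun i => ?_) (fun y => h (Fin.cons t y))
      · rw [← this]
        refine Finset.sum_congr rfl fun i _ => ?_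
        rw [Set.indicator_apply]
        congr 1
        refine propext ⟨?_, ?_⟩
        · rintro ⟨x, hx, rfl⟩
          exact ⟨Fin.tail x, by simpa using hx⟩
        · rintro ⟨y, hy⟩
          exact ⟨_, hy, by simp⟩
      · refine (((hK i).image (f := fun x : Fin (n + 1) → ℝ => Fin.tail x) ?_)).of_isClosed_subset
          ((hK i).isClosed.preimage hcont) ?_
        · unfold Fin.tail; fun_prop
        · intro y hy
          exact ⟨_, hy, by simp⟩
      · intro x hx y hy p q hp hq hpq
        have := hconv i hx hy hp hq hpq
        simp only [Set.mem_preimage]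
        convert this using 1
        ext j
        refine Fin.cases ?_ (fun j => ?_) j
        · simp [← add_mul, hpq]
        · simp
    refine (Finset.sum_congr rfl fun i _ => ?_).trans
      (sum_nonempty_eq_zero_of_compact_intervals s a I hIc hIconv hsum)
    rw [Set.indicator_apply]
    congr 1
    refine propext ⟨fun hne => (hIc i).sSup_mem (hne.image _), ?_⟩
    rintro ⟨x, hx, -⟩
    exact ⟨x, hx⟩

theorem castVec_add {d : ℕ} (x y : Fin d → ℤ) : castVec (x + y) = castVec x + castVec y := by
  ext; simp [castVec]

theorem castVec_neg {d : ℕ} (x : Fin d → ℤ) : castVec (-x) = -castVec x := by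
  ext; simp [castVec]

theorem castVec_sub {d : ℕ} (x y : Fin d → ℤ) : castVec (x - y) = castVec x - castVec y := by
  ext; simp [castVec]

theorem castVec_sum {d : ℕ} {ι : Type*} (s : Finset ι) (v : ι → Fin d → ℤ) :
    castVec (∑ i ∈ s, v i) = ∑ i ∈ s, castVec (v i) := by
  ext; simp [castVec]

theorem finite_setOf_castVec_mem {d : ℕ} {S : Set (Fin d → ℝ)} (hS : Bornology.IsBounded S) :
    {x : Fin d → ℤ | castVec x ∈ S}.Finite := by
  obtain ⟨R, hR⟩ := hS.exists_norm_le
  refine (Set.finite_Icc (fun _ => -⌈R⌉ : Fin d → ℤ) (fun _ => ⌈R⌉)).subset fun x hx => ?_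
  have h : ∀ i, |(x i : ℝ)| ≤ ⌈R⌉ := fun i =>
    ((norm_le_pi_norm (castVec x) i).trans (hR _ hx)).trans (Int.le_ceil R)
  refine ⟨fun i => ?_, fun i => ?_⟩
  · exact_mod_cast (abs_le.1 (h i)).1
  · exact_mod_cast (abs_le.1 (h i)).2

open Classical in
theorem latCount_eq_sum {d : ℕ} {S : Set (Fin d → ℝ)} (Z : Finset (Fin d → ℤ))
    (hZ : ∀ z, castVec z ∈ S → z ∈ Z) :
    (latCount S : ℤ) = ∑ z ∈ Z, if castVec z ∈ S then 1 else 0 := by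
  rw [latCount, Finset.sum_boole, ← Set.ncard_coe_finset]
  congr 2
  ext z
  simpa using fun h => hZ z h

theorem latCount_castVec_vadd {d : ℕ} (a : Fin d → ℤ) (S : Set (Fin d → ℝ)) :
    latCount (castVec a +ᵥ S) = latCount S := by
  have : {x : Fin d → ℤ | castVec x ∈ castVec a +ᵥ S}
      = (fun x => a + x) '' {x | castVec x ∈ S} := by
    ext x
    simp only [Set.mem_ofPred_eq, Set.mem_image, Set.mem_vadd_set_iff_neg_vadd_mem, vadd_eq_add]
    constructor
    · intro h
      exact ⟨-a + x, by rwa [castVec_add, castVec_neg], by simp⟩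
    · rintro ⟨y, hy, rfl⟩
      rwa [castVec_add, neg_add_cancel_left]
  rw [latCount, this, Set.ncard_image_of_injective _ (add_right_injective a), latCount]

theorem latCount_neg {d : ℕ} (S : Set (Fin d → ℝ)) : latCount (-S) = latCount S := by
  have : {x : Fin d → ℤ | castVec x ∈ -S} = Neg.neg '' {x | castVec x ∈ S} := by
    ext x
    simp [castVec_neg]
  rw [latCount, this, Set.ncard_image_of_injective _ neg_injective, latCount]

theorem mem_convexHull_range_iff {E : Type*} [AddCommGroup E] [Module ℝ E] {n : ℕ} (w : Fin n → E)
    (y : E) : y ∈ convexHull ℝ (Set.range w) ↔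
      ∃ l : Fin n → ℝ, (∀ i, 0 ≤ l i) ∧ ∑ i, l i = 1 ∧ ∑ i, l i • w i = y := by
  classical
  constructor
  · intro hy
    have : Set.range w = (Fintype.linearCombination ℝ w : (Fin n → ℝ) →ₗ[ℝ] E) ''
        (Set.range fun i : Fin n => Pi.single i (1 : ℝ)) := by
      rw [← Set.range_comp]
      congr 1
      ext i
      simp
    rw [this, ← LinearMap.image_convexHull, convexHull_rangle_single_eq_stdSimplex] at hy
    obtain ⟨l, hl, rfl⟩ := hy
    exact ⟨l, hl.1, hl.2, rfl⟩
  · rintro ⟨l, h0, h1, rfl⟩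
    exact mem_convexHull_of_exists_fintype l w h0 h1 (fun i => ⟨i, rfl⟩) rfl

theorem mem_smul_convexHull_range_iff {E : Type*} [AddCommGroup E] [Module ℝ E] {n : ℕ}
    (hn : 0 < n) (w : Fin n → E) (m : ℕ) (y : E) :
    y ∈ (m : ℝ) • convexHull ℝ (Set.range w) ↔
      ∃ l : Fin n → ℝ, (∀ i, 0 ≤ l i) ∧ ∑ i, l i = m ∧ ∑ i, l i • w i = y := by
  rw [Set.mem_smul_set]
  constructor
  · rintro ⟨x, hx, rfl⟩
    obtain ⟨l, h0, h1, rfl⟩ := (mem_convexHull_range_iff w x).1 hx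
    refine ⟨fun i => m * l i, fun i => mul_nonneg m.cast_nonneg (h0 i), ?_, ?_⟩
    · rw [← Finset.mul_sum, h1, mul_one]
    · simp [Finset.smul_sum, mul_smul]
  · rintro ⟨l, h0, h1, rfl⟩
    rcases Nat.eq_zero_or_pos m with rfl | hm
    · refine ⟨w ⟨0, hn⟩, subset_convexHull _ _ ⟨_, rfl⟩, ?_⟩
      have : ∀ i, l i = 0 := by
        intro i
        rw [Nat.cast_zero] at h1
        exact (Finset.sum_eq_zero_iff_of_nonneg fun i _ => h0 i).1 h1 i (Finset.mem_univ i)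
      simp [this]
    · have hm' : (m : ℝ) ≠ 0 := by positivity
      refine ⟨∑ i, ((m : ℝ)⁻¹ * l i) • w i, (mem_convexHull_range_iff w _).2
        ⟨fun i => (m : ℝ)⁻¹ * l i, fun i => mul_nonneg (by positivity) (h0 i), ?_, rfl⟩, ?_⟩
      · rw [← Finset.mul_sum, h1, inv_mul_cancel₀ hm']
      · simp [Finset.smul_sum, smul_smul, hm']

open Classical in
/-- McMullen's relation `∏ i, ([P] - [w i]) = 0` in the polytope algebra, multiplied by `[t P]`. -/
theorem sum_neg_one_pow_mem_vadd_smul_eq_zero {d n : ℕ} (hn : 0 < n) (w : Fin n → Fin d → ℝ)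
    (t : ℕ) (y : Fin d → ℝ) :
    ∑ S : Finset (Fin n),
      (if y ∈ (∑ i ∈ S, w i) +ᵥ ((t + n - S.card : ℕ) : ℝ) • convexHull ℝ (Set.range w)
        then (-1 : ℤ) ^ S.card else 0) = 0 := by
  set K : Finset (Fin n) → Set (Fin n → ℝ) := fun S =>
    {l | (∀ i, 0 ≤ l i) ∧ (∀ i ∈ S, 1 ≤ l i) ∧ ∑ i, l i = (t + n : ℕ) ∧ ∑ i, l i • w i = y} with hK
  have hclosed : ∀ S, IsClosed (K S) := by
    intro S
    simp only [hK, Set.ofPred_and, Set.ofPred_forall]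
    refine (isClosed_iInter fun i => isClosed_le (by fun_prop) (by fun_prop)).inter
      ((isClosed_iInter fun i => isClosed_iInter fun _ =>
        isClosed_le (by fun_prop) (by fun_prop)).inter
      ((isClosed_eq (by fun_prop) (by fun_prop)).inter (isClosed_eq (by fun_prop) (by fun_prop))))
  have hcompact : ∀ S, IsCompact (K S) := by
    intro S
    refine (isCompact_Icc (a := (0 : Fin n → ℝ)) (b := fun _ => (t + n : ℕ))).of_isClosed_subset
      (hclosed S) ?_
    rintro l ⟨h0, -, h2, -⟩
    exact ⟨h0, fun i => h2 ▸ Finset.single_le_sum (fun j _ => h0 j) (Finset.mem_univ i)⟩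
  have hconv : ∀ S, Convex ℝ (K S) := by
    rintro S l ⟨h0, h1, h2, h3⟩ l' ⟨h0', h1', h2', h3'⟩ p q hp hq hpq
    refine ⟨fun i => ?_, fun i hi => ?_, ?_, ?_⟩
    · have := mul_nonneg hp (h0 i)
      have := mul_nonneg hq (h0' i)
      simp only [Pi.add_apply, Pi.smul_apply, smul_eq_mul]
      linarith
    · have := mul_le_mul_of_nonneg_left (h1 i hi) hp
      have := mul_le_mul_of_nonneg_left (h1' i hi) hq
      simp only [Pi.add_apply, Pi.smul_apply, smul_eq_mul]
      linarith
    · simp only [Pi.add_apply, Pi.smul_apply, smul_eq_mul, Finset.sum_add_distrib,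
        ← Finset.mul_sum, h2, h2']
      rw [← add_mul, hpq, one_mul]
    · simp only [Pi.add_apply, Pi.smul_apply, smul_eq_mul, add_smul, Finset.sum_add_distrib,
        mul_smul, ← Finset.smul_sum, h3, h3']
      rw [← add_smul, hpq, one_smul]
  refine Eq.trans (Finset.sum_congr rfl fun S _ => ?_)
    (sum_nonempty_eq_zero_of_sum_indicator_eq_zero Finset.univ (fun S => (-1) ^ S.card) K hcompact
      hconv fun l => ?_)
  · congr 1
    have hcard : S.card ≤ n := by simpa using S.card_le_univ
    have hcast : ((t + n - S.card : ℕ) : ℝ) = (t + n : ℕ) - S.card := by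
      rw [Nat.cast_sub (by omega)]
    rw [Set.mem_vadd_set_iff_neg_vadd_mem, mem_smul_convexHull_range_iff hn, hcast]
    refine propext ⟨?_, ?_⟩
    · rintro ⟨l, h0, h1, h2⟩
      refine ⟨fun i => l i + if i ∈ S then 1 else 0, fun i => ?_, fun i hi => ?_, ?_, ?_⟩
      · have := h0 i
        dsimp only
        split_ifs <;> linarith
      · simpa [hi] using h0 i
      · rw [Finset.sum_add_distrib, h1]
        simp
      · simp [add_smul, Finset.sum_add_distrib, h2, ite_smul]
    · rintro ⟨l, h0, h1, h2, h3⟩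
      refine ⟨fun i => l i - if i ∈ S then 1 else 0, fun i => ?_, ?_, ?_⟩
      · dsimp only
        split_ifs with h
        · simpa using h1 i h
        · simpa using h0 i
      · rw [Finset.sum_sub_distrib, h2]
        simp
      · simp only [sub_smul, Finset.sum_sub_distrib, h3, ite_smul, vadd_eq_add]
        simp [sub_eq_neg_add]
  · by_cases hl : (∀ i, 0 ≤ l i) ∧ ∑ i, l i = (t + n : ℕ) ∧ ∑ i, l i • w i = y
    · set T : Finset (Fin n) := Finset.univ.filter fun i => 1 ≤ l i with hT
      have hTne : T.Nonempty := by
        by_contra hempty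
        rw [Finset.not_nonempty_iff_eq_empty, Finset.filter_eq_empty_iff] at hempty
        have : ∑ i, l i < ∑ _i : Fin n, (1 : ℝ) :=
          Finset.sum_lt_sum_of_nonempty ⟨⟨0, hn⟩, Finset.mem_univ _⟩
            fun i hi => not_le.1 (hempty hi)
        rw [hl.2.1] at this
        simp at this
        have h' : (0 : ℝ) ≤ t := t.cast_nonneg
        linarith
      have hmem : ∀ S, l ∈ K S ↔ S ∈ T.powerset := by
        intro S
        rw [Finset.mem_powerset]
        refine ⟨fun h i hi => by simpa [hT] using h.2.1 i hi,
          fun h => ⟨hl.1, fun i hi => ?_, hl.2⟩⟩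
        simpa [hT] using h hi
      simp only [hmem, Finset.sum_ite_mem, Finset.univ_inter]
      exact Finset.sum_powerset_neg_one_pow_card_of_nonempty hTne
    · refine Finset.sum_eq_zero fun S _ => if_neg fun h => hl ⟨h.1, h.2.2⟩

theorem exists_polynomial_of_fwdDiff_iter_eq_zero (L : ℕ → ℤ) (n : ℕ)
    (h : ∀ t, (fwdDiff 1)^[n] L t = 0) :
    ∃ p : Polynomial ℚ, ∀ t : ℕ, (L t : ℚ) = p.eval (t : ℚ) := by
  have hk : ∀ k, n ≤ k → (fwdDiff 1)^[k] L 0 = 0 := by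
    intro k hk
    obtain ⟨j, rfl⟩ := Nat.exists_eq_add_of_le' hk
    have : (fwdDiff 1)^[n] L = fun _ => 0 := funext h
    rw [Function.iterate_add_apply, this, ← Pi.zero_def]
    clear hk
    induction j with
    | zero => rfl
    | succ j ih => rwa [Function.iterate_succ_apply, Pi.zero_def, fwdDiff_const, ← Pi.zero_def]
  refine ⟨∑ k ∈ Finset.range n, Polynomial.C ((((fwdDiff 1)^[k] L 0 : ℤ) : ℚ) / k.factorial) *
    descPochhammer ℚ k, fun t => ?_⟩
  have h1 := shift_eq_sum_fwdDiff_iter 1 L t 0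
  have h2 : ∑ k ∈ Finset.range (t + 1), t.choose k • (fwdDiff 1)^[k] L 0
      = ∑ k ∈ Finset.range n, t.choose k • (fwdDiff 1)^[k] L 0 := by
    rcases le_total (t + 1) n with hle | hle
    · refine Finset.sum_subset (Finset.range_mono hle) fun k _ hk' => ?_
      rw [Finset.mem_range, not_lt] at hk'
      rw [Nat.choose_eq_zero_of_lt hk', zero_smul]
    · refine (Finset.sum_subset (Finset.range_mono hle) fun k _ hk' => ?_).symm
      rw [Finset.mem_range, not_lt] at hk'
      rw [hk k hk', smul_zero]
  rw [smul_eq_mul, mul_one, zero_add, h2] at h1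
  rw [h1, Polynomial.eval_finsetSum]
  push_cast
  refine Finset.sum_congr rfl fun k _ => ?_
  rw [Polynomial.eval_mul, Polynomial.eval_C, descPochhammer_eval_eq_descFactorial,
    nsmul_eq_mul, Nat.descFactorial_eq_factorial_mul_choose]
  have : (k.factorial : ℚ) ≠ 0 := by exact_mod_cast k.factorial_ne_zero
  push_cast
  field_simp

theorem IsLatticePolytope.exists_range {d : ℕ} {P : Set (Fin d → ℝ)} (hP : IsLatticePolytope P) :
    ∃ (n : ℕ) (_ : 0 < n) (v : Fin n → Fin d → ℤ),
      P = convexHull ℝ (Set.range fun i => castVec (v i)) := by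
  obtain ⟨V, hV, rfl⟩ := hP
  refine ⟨V.card, hV.card_pos, fun i => (V.equivFin.symm i : Fin d → ℤ), ?_⟩
  congr 1
  ext x
  simp only [Set.mem_image, Set.mem_range]
  constructor
  · rintro ⟨a, ha, rfl⟩
    exact ⟨V.equivFin ⟨a, ha⟩, by simp⟩
  · rintro ⟨i, rfl⟩
    exact ⟨_, (V.equivFin.symm i).2, rfl⟩

/-- Ehrhart's theorem for translates of a lattice polytope. -/
theorem IsLatticePolytope.exists_polynomial_latCount {d : ℕ} {P : Set (Fin d → ℝ)}
    (hP : IsLatticePolytope P) (x : Fin d → ℝ) :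
    ∃ p : Polynomial ℚ, ∀ t : ℕ, (latCount (x +ᵥ (t : ℝ) • P) : ℚ) = p.eval (t : ℚ) := by
  classical
  obtain ⟨n, hn, v, rfl⟩ := hP.exists_range
  set P := convexHull ℝ (Set.range fun i => castVec (v i)) with hPdef
  have hPb : Bornology.IsBounded P :=
    isBounded_convexHull.2 (Set.finite_range _).isBounded
  suffices h : ∀ t, (fwdDiff 1)^[n] (fun t : ℕ => (latCount (x +ᵥ (t : ℝ) • P) : ℤ)) t = 0 by
    obtain ⟨p, hp⟩ := exists_polynomial_of_fwdDiff_iter_eq_zero _ n h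
    exact ⟨p, fun t => by rw [← hp]; simp⟩
  intro t
  have hfin : (⋃ S : Finset (Fin n), {z : Fin d → ℤ | castVec z ∈ castVec (∑ i ∈ S, v i) +ᵥ
      (x +ᵥ ((t + n - S.card : ℕ) : ℝ) • P)}).Finite :=
    Set.finite_iUnion fun S =>
      finite_setOf_castVec_mem (((hPb.smul₀ _).vadd _).vadd _)
  have hsum : ∑ S : Finset (Fin n),
      (-1 : ℤ) ^ S.card * (latCount (x +ᵥ ((t + n - S.card : ℕ) : ℝ) • P) : ℤ) = 0 := by
    have : ∀ S : Finset (Fin n),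
        (-1 : ℤ) ^ S.card * (latCount (x +ᵥ ((t + n - S.card : ℕ) : ℝ) • P) : ℤ)
        = ∑ z ∈ hfin.toFinset, if castVec z - x ∈
          (∑ i ∈ S, castVec (v i)) +ᵥ ((t + n - S.card : ℕ) : ℝ) • P
            then (-1 : ℤ) ^ S.card else 0 := by
      intro S
      rw [← latCount_castVec_vadd (∑ i ∈ S, v i), latCount_eq_sum hfin.toFinset, Finset.mul_sum]
      · refine Finset.sum_congr rfl fun z _ => ?_
        rw [mul_ite, mul_one, mul_zero]
        congr 1
        rw [castVec_sum, vadd_comm, Set.mem_vadd_set_iff_neg_vadd_mem, vadd_eq_add,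
          sub_eq_neg_add]
      · intro z hz
        simp only [Set.Finite.mem_toFinset, Set.mem_iUnion]
        exact ⟨S, hz⟩
    simp_rw [this]
    rw [Finset.sum_comm]
    exact Finset.sum_eq_zero fun z _ => sum_neg_one_pow_mem_vadd_smul_eq_zero hn _ t _
  rw [fwdDiff_iter_eq_sum_shift, ← Finset.sum_flip, ← hsum, ← Finset.powerset_univ,
    Finset.sum_powerset_apply_card
      (fun j => (-1 : ℤ) ^ j * (latCount (x +ᵥ ((t + n - j : ℕ) : ℝ) • P) : ℤ)),
    Finset.card_univ, Fintype.card_fin]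
  refine Finset.sum_congr rfl fun k hk => ?_
  have hk' : k ≤ n := Nat.lt_succ_iff.1 (Finset.mem_range.1 hk)
  rw [Nat.choose_symm hk', Nat.sub_sub_self hk', smul_eq_mul, smul_eq_mul, mul_one, nsmul_eq_mul,
    Nat.add_sub_assoc hk']
  ring

/-- The real numbers are approximated pointwise by `ℚ`-linear retractions `ℝ → ℚ`. -/
theorem exists_seq_linearMap_tendsto :
    ∃ φ : ℕ → ℝ →ₗ[ℚ] ℚ, (∀ k, φ k 1 = 1) ∧
      ∀ r, Filter.Tendsto (fun k => (φ k r : ℝ)) Filter.atTop (nhds r) := by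
  set b := Module.Basis.ofVectorSpace ℚ ℝ with hb
  have hseq : ∀ x : ℝ, ∃ a : ℕ → ℚ, Filter.Tendsto (fun k => (a k : ℝ)) Filter.atTop (nhds x) := by
    intro x
    obtain ⟨a, -, -, ha⟩ := DenseRange.exists_seq_strictMono_tendsto Rat.denseRange_cast
      Rat.cast_mono x
    exact ⟨a, ha⟩
  choose q hq using hseq
  set ψ : ℕ → ℝ →ₗ[ℚ] ℚ := fun k => b.constr ℚ fun i => q (b i) k with hψ
  have hψt : ∀ r, Filter.Tendsto (fun k => (ψ k r : ℝ)) Filter.atTop (nhds r) := by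
    intro r
    have h1 : ∀ k, (ψ k r : ℝ) = ∑ i ∈ (b.repr r).support, (b.repr r i : ℝ) * (q (b i) k : ℝ) := by
      intro k
      simp [hψ, Module.Basis.constr_apply, Finsupp.sum]
    have h2 : r = ∑ i ∈ (b.repr r).support, (b.repr r i : ℝ) * b i := by
      conv_lhs => rw [← b.linearCombination_repr r, Finsupp.linearCombination_apply, Finsupp.sum]
      simp [Rat.smul_def]
    simp_rw [h1]
    conv_rhs => rw [h2]
    exact tendsto_finsetSum _ fun i _ => (hq (b i)).const_mul _
  have hne : ∀ᶠ k in Filter.atTop, ψ k 1 ≠ 0 := by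
    filter_upwards [(hψt 1).eventually_ne one_ne_zero] with k hk
    exact_mod_cast hk
  obtain ⟨N, hN⟩ := Filter.eventually_atTop.1 hne
  refine ⟨fun k => (ψ (k + N) 1)⁻¹ • ψ (k + N), fun k => ?_, fun r => ?_⟩
  · simp [hN (k + N) (Nat.le_add_left _ _)]
  · have h := (((hψt 1).inv₀ one_ne_zero).mul (hψt r)).comp (Filter.tendsto_add_atTop_nat N)
    simpa [Function.comp_def] using h

theorem eventually_latCount_ratVec_vadd_eq {d n : ℕ} (v : Fin n → Fin d → ℤ)
    {φ : ℕ → ℝ →ₗ[ℚ] ℚ} (hφ1 : ∀ k, φ k 1 = 1)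
    (hφ : ∀ r, Filter.Tendsto (fun k => (φ k r : ℝ)) Filter.atTop (nhds r)) (x : Fin d → ℝ) :
    ∀ᶠ k in Filter.atTop,
      latCount (ratVec (fun j => φ k (x j)) +ᵥ convexHull ℝ (Set.range fun i => castVec (v i))) =
        latCount (x +ᵥ convexHull ℝ (Set.range fun i => castVec (v i))) := by
  set P := convexHull ℝ (Set.range fun i => castVec (v i)) with hP
  have hPc : IsCompact P := (Set.finite_range _).isCompact_convexHull ℝ
  have hx : Filter.Tendsto (fun k => ratVec (fun j => φ k (x j))) Filter.atTop (nhds x) :=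
    tendsto_pi_nhds.2 fun j => hφ (x j)
  have hmem : ∀ (y : Fin d → ℝ) z, castVec z ∈ y +ᵥ P ↔ castVec z - y ∈ P := by
    intro y z
    rw [Set.mem_vadd_set_iff_neg_vadd_mem, vadd_eq_add, sub_eq_neg_add]
  have hfin : {z : Fin d → ℤ | castVec z ∈ Metric.closedBall x 1 + P}.Finite :=
    finite_setOf_castVec_mem (Metric.isBounded_closedBall.add hPc.isBounded)
  have hsub : ∀ y ∈ Metric.closedBall x 1, ∀ z, castVec z ∈ y +ᵥ P → z ∈ hfin.toFinset := by
    intro y hy z hz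
    rw [hmem] at hz
    rw [Set.Finite.mem_toFinset]
    exact ⟨y, hy, _, hz, by simp⟩
  have hev : ∀ᶠ k in Filter.atTop, ∀ z ∈ hfin.toFinset,
      (castVec z ∈ ratVec (fun j => φ k (x j)) +ᵥ P ↔ castVec z ∈ x +ᵥ P) := by
    rw [Filter.eventually_all_finset]
    intro z _
    simp_rw [hmem]
    by_cases hz : castVec z - x ∈ P
    · obtain ⟨l, h0, h1, h2⟩ := (mem_convexHull_range_iff _ _).1 hz
      have hpos : ∀ᶠ k in Filter.atTop, ∀ i, 0 ≤ φ k (l i) := by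
        rw [Filter.eventually_all]
        intro i
        rcases (h0 i).eq_or_lt with h | h
        · simp [← h]
        · filter_upwards [(hφ (l i)).eventually_const_le h] with k hk
          exact_mod_cast hk
      filter_upwards [hpos] with k hk
      simp only [hz, iff_true]
      refine (mem_convexHull_range_iff _ _).2 ⟨fun i => φ k (l i),
        fun i => Rat.cast_nonneg.2 (hk i), ?_, ?_⟩
      · dsimp only
        have := congrArg (φ k) h1
        rw [map_sum, hφ1] at this
        exact_mod_cast this
      · ext j
        have := congrArg (φ k) (congrFun h2 j)
        have hmul : ∀ (r : ℝ) (a : ℤ), φ k (r * a) = φ k r * a := by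
          intro r a
          rw [mul_comm, ← zsmul_eq_mul, map_zsmul, zsmul_eq_mul, mul_comm]
        have hint : ∀ a : ℤ, φ k a = a := by
          intro a
          simpa [hφ1] using hmul 1 a
        simp only [Finset.sum_apply, Pi.smul_apply, Pi.sub_apply, castVec, smul_eq_mul, map_sum,
          map_sub, hmul, hint] at this
        simp only [Finset.sum_apply, Pi.smul_apply, Pi.sub_apply, castVec, smul_eq_mul, ratVec]
        exact_mod_cast this
    · have : Filter.Tendsto (fun k => castVec z - ratVec (fun j => φ k (x j))) Filter.atTop
          (nhds (castVec z - x)) := hx.const_sub _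
      filter_upwards [this (hPc.isClosed.isOpen_compl.mem_nhds hz)] with k hk
      simp only [hz, iff_false]
      exact hk
  filter_upwards [hev, hx (Metric.closedBall_mem_nhds x one_pos)] with k hk hk'
  unfold latCount
  congr 1
  ext z
  exact ⟨fun h => (hk z (hsub _ hk' z h)).1 h,
    fun h => (hk z (hsub _ (Metric.mem_closedBall_self zero_le_one) z h)).2 h⟩

theorem latCount_vadd_eq_of_ratVec {d : ℕ} {P Q : Set (Fin d → ℝ)} (hP : IsLatticePolytope P)
    (hQ : IsLatticePolytope Q)
    (h : ∀ c : Fin d → ℚ, latCount (ratVec c +ᵥ P) = latCount (ratVec c +ᵥ Q)) (x : Fin d → ℝ) :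
    latCount (x +ᵥ P) = latCount (x +ᵥ Q) := by
  obtain ⟨n, -, v, rfl⟩ := hP.exists_range
  obtain ⟨m, -, w, rfl⟩ := hQ.exists_range
  obtain ⟨φ, hφ1, hφ⟩ := exists_seq_linearMap_tendsto
  obtain ⟨k, hk, hk'⟩ := ((eventually_latCount_ratVec_vadd_eq v hφ1 hφ x).and
    (eventually_latCount_ratVec_vadd_eq w hφ1 hφ x)).exists
  rw [← hk, ← hk', h]

open Classical in
theorem latCount_add_eq {d : ℕ} {P Q K : Set (Fin d → ℝ)} (hP : IsCompact P) (hPc : Convex ℝ P)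
    (hQ : IsCompact Q) (hQc : Convex ℝ Q) (hK : IsCompact K) (hKc : Convex ℝ K)
    (h : ∀ x : Fin d → ℝ, latCount (x +ᵥ P) = latCount (x +ᵥ Q)) :
    latCount (P + K) = latCount (Q + K) := by
  have hfin : {z : Fin d → ℤ | castVec z ∈ (P + K) ∪ (Q + K)}.Finite :=
    finite_setOf_castVec_mem
      ((hP.isBounded.add hK.isBounded).union (hQ.isBounded.add hK.isBounded))
  set Z := hfin.toFinset with hZ
  have hZP : ∀ z, castVec z ∈ P + K → z ∈ Z := fun z hz => hfin.mem_toFinset.2 (Or.inl hz)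
  have hZQ : ∀ z, castVec z ∈ Q + K → z ∈ Z := fun z hz => hfin.mem_toFinset.2 (Or.inr hz)
  let F : Set (Fin d → ℝ) → (Fin d → ℤ) → Set (Fin d → ℝ) :=
    fun R z => (fun y => castVec z - y) ⁻¹' R ∩ K
  have hFc : ∀ R z, IsCompact R → IsCompact (F R z) := fun R z hR =>
    hK.inter_left (hR.isClosed.preimage (by fun_prop))
  have hFconv : ∀ R z, Convex ℝ R → Convex ℝ (F R z) := by
    intro R z hR
    refine Convex.inter (fun x hx y hy p q hp hq hpq => ?_) hKc
    have := hR hx hy hp hq hpq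
    simp only [Set.mem_preimage]
    convert this using 1
    rw [smul_sub, smul_sub, sub_add_sub_comm, ← add_smul, hpq, one_smul]
  have hmem : ∀ R z y, y ∈ K → (y ∈ F R z ↔ castVec z ∈ y +ᵥ R) := by
    intro R z y hy
    rw [Set.mem_vadd_set_iff_neg_vadd_mem, vadd_eq_add, ← sub_eq_neg_add]
    exact ⟨fun h => h.1, fun h => ⟨h, hy⟩⟩
  have hne : ∀ R z, (F R z).Nonempty ↔ castVec z ∈ R + K := by
    intro R z
    constructor
    · rintro ⟨y, hy, hyK⟩
      exact ⟨_, hy, y, hyK, by simp⟩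
    · rintro ⟨r, hr, y, hyK, hz⟩
      exact ⟨y, by simpa [← hz] using hr, hyK⟩
  have hneg : ∀ p : (Fin d → ℤ) → Prop,
      ∑ z ∈ Z, (if p z then (-1 : ℤ) else 0) = -∑ z ∈ Z, (if p z then 1 else 0) := by
    intro p
    rw [← Finset.sum_neg_distrib]
    exact Finset.sum_congr rfl fun z _ => by split_ifs <;> simp
  have key := sum_nonempty_eq_zero_of_sum_indicator_eq_zero (Z.disjSum Z)
    (Sum.elim (fun _ => 1) (fun _ => -1)) (Sum.elim (F P) (F Q))
    (by rintro (z | z); exacts [hFc _ _ hP, hFc _ _ hQ])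
    (by rintro (z | z); exacts [hFconv _ _ hPc, hFconv _ _ hQc]) (fun y => ?_)
  · simp only [Finset.sum_disjSum, Sum.elim_inl, Sum.elim_inr, hne] at key
    zify
    rw [latCount_eq_sum Z hZP, latCount_eq_sum Z hZQ]
    rw [hneg] at key
    linarith
  · simp only [Finset.sum_disjSum, Sum.elim_inl, Sum.elim_inr]
    by_cases hy : y ∈ K
    · simp only [hmem _ _ _ hy]
      have hsub : ∀ (R : Set (Fin d → ℝ)) z, castVec z ∈ y +ᵥ R → castVec z ∈ R + K := by
        rintro R z ⟨r, hr, hz⟩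
        exact ⟨r, hr, y, hy, by rw [← hz]; exact add_comm _ _⟩
      have h1 := h y
      zify at h1
      rw [latCount_eq_sum Z fun z hz => hZP z (hsub P z hz),
        latCount_eq_sum Z fun z hz => hZQ z (hsub Q z hz)] at h1
      rw [hneg]
      linarith
    · simp [F, hy]

/-- The lattice points on the face of `P` on which `u` is maximal. -/
def faceLatticePoints {d : ℕ} (P : Set (Fin d → ℝ)) (u : Fin d → ℝ) : Set (Fin d → ℤ) :=
  {z | castVec z ∈ P ∧ ∀ p ∈ P, u ⬝ᵥ p ≤ u ⬝ᵥ castVec z}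

theorem eventually_latCount_add_ncard_faceLatticePoints {d : ℕ} {P : Set (Fin d → ℝ)}
    (hP : IsCompact P) (hPc : Convex ℝ P) (u : Fin d → ℝ) :
    ∀ᶠ ε in nhdsWithin (0 : ℝ) (Set.Ioi 0), ∀ᶠ δ in nhdsWithin (0 : ℝ) (Set.Ioi 0),
      latCount (P + (Metric.closedBall 0 ε ∩ {y | u ⬝ᵥ y ≤ -δ})) +
        (faceLatticePoints P u).ncard = latCount P := by
  have hfin1 : {z : Fin d → ℤ | castVec z ∈ P + Metric.closedBall 0 1}.Finite :=
    finite_setOf_castVec_mem (hP.isBounded.add Metric.isBounded_closedBall)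
  have hfin : {z : Fin d → ℤ | castVec z ∈ P}.Finite := finite_setOf_castVec_mem hP.isBounded
  have h1 : ∀ᶠ ε in nhdsWithin (0 : ℝ) (Set.Ioi 0), ∀ z ∈ hfin1.toFinset,
      castVec z ∈ P + Metric.closedBall 0 ε → castVec z ∈ P := by
    rw [Filter.eventually_all_finset]
    intro z _
    by_cases hz : castVec z ∈ P
    · simp [hz]
    obtain ⟨r, hr, hball⟩ := Metric.isOpen_iff.1 hP.isClosed.isOpen_compl _ hz
    filter_upwards [Ioo_mem_nhdsGT hr] with ε hε
    rintro ⟨p, hp, y, hy, hpy⟩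
    refine absurd hp (hball ?_)
    rw [mem_closedBall_zero_iff] at hy
    rw [mem_ball_iff_norm, ← hpy]
    simpa using hy.trans_lt hε.2
  filter_upwards [h1, Ioo_mem_nhdsGT one_pos] with ε hε1 ⟨hε0, hε⟩
  have h2 : ∀ᶠ δ in nhdsWithin (0 : ℝ) (Set.Ioi 0), ∀ z ∈ hfin.toFinset,
      (∃ p ∈ P, u ⬝ᵥ castVec z < u ⬝ᵥ p) →
        castVec z ∈ P + (Metric.closedBall 0 ε ∩ {y | u ⬝ᵥ y ≤ -δ}) := by
    rw [Filter.eventually_all_finset]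
    intro z hz
    rw [Set.Finite.mem_toFinset] at hz
    by_cases hp : ∃ p ∈ P, u ⬝ᵥ castVec z < u ⬝ᵥ p
    swap
    · simp [hp]
    obtain ⟨p, hp, hlt⟩ := hp
    set τ := min 1 (ε / (‖castVec z - p‖ + 1)) with hτ
    have hτ0 : 0 < τ := lt_min one_pos (by positivity)
    have hτ1 : τ ≤ 1 := min_le_left _ _
    have hτ2 : τ * (‖castVec z - p‖ + 1) ≤ ε :=
      (le_div_iff₀ (by positivity)).1 (min_le_right _ _)
    filter_upwards [Ioo_mem_nhdsGT (mul_pos hτ0 (sub_pos.2 hlt))] with δ hδ _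
    refine ⟨castVec z + τ • (p - castVec z), hPc.add_smul_sub_mem hz hp ⟨hτ0.le, hτ1⟩,
      τ • (castVec z - p), ⟨?_, ?_⟩, ?_⟩
    · rw [mem_closedBall_zero_iff, norm_smul, Real.norm_of_nonneg hτ0.le]
      linarith
    · have := hδ.2.le
      simp only [Set.mem_ofPred_eq, dotProduct_smul, dotProduct_sub, smul_eq_mul]
      linarith
    · simp only [smul_sub]
      abel
  filter_upwards [h2, self_mem_nhdsWithin] with δ hδ hδ0
  have hset : {z : Fin d → ℤ | castVec z ∈ P + (Metric.closedBall 0 ε ∩ {y | u ⬝ᵥ y ≤ -δ})} =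
      {z | castVec z ∈ P} \ faceLatticePoints P u := by
    ext z
    constructor
    · rintro ⟨p, hp, y, ⟨hy, hyu⟩, hpy⟩
      have hz : castVec z ∈ P := by
        refine hε1 z ?_ ⟨p, hp, y, hy, hpy⟩
        rw [Set.Finite.mem_toFinset]
        exact ⟨p, hp, y, Metric.closedBall_subset_closedBall hε.le hy, hpy⟩
      refine ⟨hz, fun h => ?_⟩
      have h3 := h.2 p hp
      simp only [← hpy, dotProduct_add, Set.mem_ofPred_eq] at h3 hyu
      linarith [Set.mem_Ioi.1 hδ0]
    · rintro ⟨hz, hz'⟩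
      refine hδ z (hfin.mem_toFinset.2 hz) ?_
      by_contra! h
      exact hz' ⟨hz, h⟩
  rw [latCount, hset]
  exact Set.ncard_sdiff_add_ncard_of_subset (fun z hz => hz.1) hfin

theorem ncard_faceLatticePoints_eq {d : ℕ} {P Q : Set (Fin d → ℝ)} (hP : IsCompact P)
    (hPc : Convex ℝ P) (hQ : IsCompact Q) (hQc : Convex ℝ Q)
    (h : ∀ x : Fin d → ℝ, latCount (x +ᵥ P) = latCount (x +ᵥ Q)) (u : Fin d → ℝ) :
    (faceLatticePoints P u).ncard = (faceLatticePoints Q u).ncard := by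
  obtain ⟨ε, hε⟩ := ((eventually_latCount_add_ncard_faceLatticePoints hP hPc u).and
    (eventually_latCount_add_ncard_faceLatticePoints hQ hQc u)).exists
  obtain ⟨δ, h1, h2⟩ := (hε.1.and hε.2).exists
  have hu : Continuous fun y : Fin d → ℝ => u ⬝ᵥ y := by
    unfold dotProduct
    fun_prop
  have hK : IsCompact (Metric.closedBall (0 : Fin d → ℝ) ε ∩ {y | u ⬝ᵥ y ≤ -δ}) :=
    (isCompact_closedBall _ _).inter_right (isClosed_le hu continuous_const)
  have hKc : Convex ℝ (Metric.closedBall (0 : Fin d → ℝ) ε ∩ {y | u ⬝ᵥ y ≤ -δ}) :=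
    (convex_closedBall _ _).inter
      (convex_halfSpace_le ⟨fun x y => dotProduct_add _ _ _, fun c x => dotProduct_smul _ _ _⟩ _)
  have h3 := latCount_add_eq hP hPc hQ hQc hK hKc h
  have h4 := h 0
  rw [zero_vadd, zero_vadd] at h4
  omega

theorem continuous_dotProduct_left {d : ℕ} (a : Fin d → ℝ) :
    Continuous fun u : Fin d → ℝ => u ⬝ᵥ a := by
  unfold dotProduct
  fun_prop

theorem dense_setOf_forall_dotProduct_ne_zero {d : ℕ} {Γ : Set (Fin d → ℝ)} (hΓ : Γ.Countable) :
    Dense {u : Fin d → ℝ | ∀ a ∈ Γ, u ⬝ᵥ a = 0 → a = 0} := by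
  have hopen : ∀ a : Fin d → ℝ, IsOpen {u : Fin d → ℝ | u ⬝ᵥ a = 0 → a = 0} := by
    intro a
    by_cases ha : a = 0
    · simp [ha]
    · simpa [ha] using isOpen_ne_fun (continuous_dotProduct_left a) continuous_const
  have hdense : ∀ a : Fin d → ℝ, Dense {u : Fin d → ℝ | u ⬝ᵥ a = 0 → a = 0} := by
    intro a
    by_cases ha : a = 0
    · simp [ha]
    rw [Metric.dense_iff]
    intro u r hr
    by_cases hu : u ⬝ᵥ a = 0
    swap
    · exact ⟨u, Metric.mem_ball_self hr, fun h => absurd h hu⟩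
    have h0 : Filter.Tendsto (fun t : ℝ => u + t • a) (nhdsWithin 0 (Set.Ioi 0)) (nhds u) := by
      have : Continuous fun t : ℝ => u + t • a := by fun_prop
      simpa using (this.tendsto 0).mono_left nhdsWithin_le_nhds
    obtain ⟨t, ht, ht0⟩ := ((h0.eventually (Metric.ball_mem_nhds u hr)).and
      self_mem_nhdsWithin).exists
    refine ⟨u + t • a, ht, fun h => ?_⟩
    rw [add_dotProduct, hu, smul_dotProduct, zero_add, smul_eq_zero] at h
    exact dotProduct_self_eq_zero.1 (h.resolve_left (ne_of_gt ht0))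
  have h := dense_biInter_of_isOpen (f := fun a : Fin d → ℝ => {u | u ⬝ᵥ a = 0 → a = 0})
    (fun a _ => hopen a) hΓ (fun a _ => hdense a)
  convert h using 1
  ext u
  simp

/-- The index `i` maximizes `(⟨u, p i⟩, ⟨e, p i⟩)` lexicographically. -/
def IsLexMax {d : ℕ} {ι : Type*} (u e : Fin d → ℝ) (p : ι → Fin d → ℝ) (i : ι) : Prop :=
  ∀ j, u ⬝ᵥ p j < u ⬝ᵥ p i ∨ (u ⬝ᵥ p j = u ⬝ᵥ p i ∧ e ⬝ᵥ p j ≤ e ⬝ᵥ p i)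

section LexMax

variable {d : ℕ} {ι κ : Type*} {u e : Fin d → ℝ} {p : ι → Fin d → ℝ} {q : κ → Fin d → ℝ}

theorem exists_isLexMax [Finite ι] [Nonempty ι] (u e : Fin d → ℝ) (p : ι → Fin d → ℝ) :
    ∃ i, IsLexMax u e p i := by
  cases nonempty_fintype ι
  obtain ⟨i, -, hi⟩ := Finset.exists_max_image Finset.univ
    (fun i => toLex (u ⬝ᵥ p i, e ⬝ᵥ p i)) Finset.univ_nonempty
  exact ⟨i, fun j => Prod.Lex.toLex_le_toLex.1 (hi j (Finset.mem_univ j))⟩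

theorem IsLexMax.le {i : ι} (h : IsLexMax u e p i) (j : ι) : u ⬝ᵥ p j ≤ u ⬝ᵥ p i :=
  (h j).elim le_of_lt fun h => h.1.le

theorem IsLexMax.eventually [Finite ι] {i : ι} (h : IsLexMax u e p i)
    (hinj : ∀ j, u ⬝ᵥ p j = u ⬝ᵥ p i → e ⬝ᵥ p j = e ⬝ᵥ p i → p j = p i) :
    ∀ᶠ t in nhdsWithin (0 : ℝ) (Set.Ioi 0),
      ∀ j, p j = p i ∨ (u + t • e) ⬝ᵥ p j < (u + t • e) ⬝ᵥ p i := by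
  rw [Filter.eventually_all]
  intro j
  rcases h j with hj | ⟨hj, hj'⟩
  · have hc : ∀ a : Fin d → ℝ, Filter.Tendsto (fun t : ℝ => (u + t • e) ⬝ᵥ a)
        (nhdsWithin 0 (Set.Ioi 0)) (nhds (u ⬝ᵥ a)) := by
      intro a
      have : Continuous fun t : ℝ => (u + t • e) ⬝ᵥ a :=
        (continuous_dotProduct_left a).comp (by fun_prop)
      simpa using (this.tendsto 0).mono_left nhdsWithin_le_nhds
    filter_upwards [(hc (p j)).eventually_lt (hc (p i)) hj] with t ht
    exact Or.inr ht
  · rcases hj'.eq_or_lt with h' | h'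
    · exact Filter.Eventually.of_forall fun t => Or.inl (hinj j hj h')
    · filter_upwards [self_mem_nhdsWithin] with t ht
      right
      rw [add_dotProduct, add_dotProduct, smul_dotProduct, smul_dotProduct, hj, smul_eq_mul,
        smul_eq_mul]
      exact add_lt_add_right (mul_lt_mul_of_pos_left h' ht) _

theorem lt_or_mem_of_mem_convexHull {C : Set (Fin d → ℝ)} (hC : Convex ℝ C) {M : ℝ}
    (h : ∀ i, u ⬝ᵥ p i < M ∨ (u ⬝ᵥ p i = M ∧ p i ∈ C)) {x : Fin d → ℝ}
    (hx : x ∈ convexHull ℝ (Set.range p)) : u ⬝ᵥ x < M ∨ (u ⬝ᵥ x = M ∧ x ∈ C) := by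
  have hconv : Convex ℝ {x | u ⬝ᵥ x < M ∨ (u ⬝ᵥ x = M ∧ x ∈ C)} := by
    rw [convex_iff_forall_pos]
    intro x hx y hy a b ha hb hab
    simp only [Set.mem_ofPred_eq, dotProduct_add, dotProduct_smul, smul_eq_mul] at hx hy ⊢
    have hM : M = a * M + b * M := by rw [← add_mul, hab, one_mul]
    rcases hx with hx | ⟨hx, hxC⟩ <;> rcases hy with hy | ⟨hy, hyC⟩
    · left
      nlinarith
    · left
      nlinarith
    · left
      nlinarith
    · right
      exact ⟨by rw [hx, hy, ← hM], hC hxC hyC ha.le hb.le hab⟩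
  exact convexHull_min (by rintro _ ⟨i, rfl⟩; exact h i) hconv hx

theorem dotProduct_le_of_mem_convexHull {M : ℝ} (h : ∀ i, u ⬝ᵥ p i ≤ M) {x : Fin d → ℝ}
    (hx : x ∈ convexHull ℝ (Set.range p)) : u ⬝ᵥ x ≤ M :=
  (lt_or_mem_of_mem_convexHull convex_univ
    (fun i => (h i).lt_or_eq.imp_right fun h => ⟨h, trivial⟩) hx).elim le_of_lt fun h => h.1.le

end LexMax

theorem lexMax_sub_eq_of_le {d : ℕ} {ι κ : Type*} {u e : Fin d → ℝ} {v : ι → Fin d → ℤ}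
    {w : κ → Fin d → ℤ} {Δ : Set (Fin d → ℝ)}
    (hΔp : ∀ i j, castVec (v i) - castVec (v j) ∈ Δ)
    (hΔq : ∀ i j, castVec (w i) - castVec (w j) ∈ Δ)
    (hpar : ∀ a ∈ Δ, ∀ b ∈ Δ, u ⬝ᵥ a = 0 → u ⬝ᵥ b = 0 → (e ⬝ᵥ a) • b = (e ⬝ᵥ b) • a)
    (hne : ∀ a ∈ Δ, u ⬝ᵥ a = 0 → e ⬝ᵥ a = 0 → a = 0)
    (hfin : (faceLatticePoints (convexHull ℝ (Set.range fun j => castVec (w j))) u).Finite)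
    (hcard : (faceLatticePoints (convexHull ℝ (Set.range fun i => castVec (v i))) u).ncard =
      (faceLatticePoints (convexHull ℝ (Set.range fun j => castVec (w j))) u).ncard)
    {i₁ i₀ : ι} {j₁ j₀ : κ} (hi₁ : IsLexMax u e (fun i => castVec (v i)) i₁)
    (hi₀ : IsLexMax u (-e) (fun i => castVec (v i)) i₀)
    (hj₁ : IsLexMax u e (fun j => castVec (w j)) j₁)
    (hj₀ : IsLexMax u (-e) (fun j => castVec (w j)) j₀)
    (hle : e ⬝ᵥ (castVec (v i₁) - castVec (v i₀)) ≤ e ⬝ᵥ (castVec (w j₁) - castVec (w j₀))) :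
    castVec (v i₁) - castVec (v i₀) = castVec (w j₁) - castVec (w j₀) := by
  have hi : u ⬝ᵥ castVec (v i₁) = u ⬝ᵥ castVec (v i₀) := (hi₀.le _).antisymm (hi₁.le _)
  have hj : u ⬝ᵥ castVec (w j₁) = u ⬝ᵥ castVec (w j₀) := (hj₀.le _).antisymm (hj₁.le _)
  set α := castVec (v i₁) - castVec (v i₀) with hα
  set β := castVec (w j₁) - castVec (w j₀) with hβ
  have huα : u ⬝ᵥ α = 0 := by rw [hα, dotProduct_sub, hi, sub_self]
  have huβ : u ⬝ᵥ β = 0 := by rw [hβ, dotProduct_sub, hj, sub_self]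
  have hα0 : 0 ≤ e ⬝ᵥ α := by
    rcases hi₁ i₀ with h | ⟨-, h⟩
    · exact absurd h (by simp [hi])
    · rw [hα, dotProduct_sub]
      exact sub_nonneg.2 h
  rcases (hα0.trans hle).eq_or_lt with hβ0 | hβ0
  · rw [hne α (hΔp _ _) huα (le_antisymm (hβ0 ▸ hle) hα0), hne β (hΔq _ _) huβ hβ0.symm]
  set P := convexHull ℝ (Set.range fun i => castVec (v i)) with hP
  set Q := convexHull ℝ (Set.range fun j => castVec (w j)) with hQ
  have hqQ : ∀ j, castVec (w j) ∈ Q := fun j => subset_convexHull ℝ _ ⟨j, rfl⟩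
  have hpP : ∀ i, castVec (v i) ∈ P := fun i => subset_convexHull ℝ _ ⟨i, rfl⟩
  have hQle : ∀ y ∈ Q, u ⬝ᵥ y ≤ u ⬝ᵥ castVec (w j₀) := fun y hy =>
    dotProduct_le_of_mem_convexHull (fun j => hj₀.le j) hy
  let C : Set (Fin d → ℝ) := {x | x + (castVec (w j₀) - castVec (v i₀)) ∈ Q} ∩
    {x | e ⬝ᵥ x ≤ e ⬝ᵥ castVec (v i₁)}
  have hC : Convex ℝ C := by
    refine Convex.inter ((convex_convexHull ℝ _).translate_preimage_left _)
      (convex_halfSpace_le ⟨fun x y => dotProduct_add _ _ _, fun c x => dotProduct_smul _ _ _⟩ _)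
  have hface : ∀ x ∈ P, u ⬝ᵥ x = u ⬝ᵥ castVec (v i₀) → x ∈ C := by
    intro x hx hux
    refine ((lt_or_mem_of_mem_convexHull hC (fun i => ?_) hx).resolve_left hux.not_lt).2
    rcases hi₁ i with h | ⟨h, h'⟩
    · exact Or.inl (hi ▸ h)
    refine Or.inr ⟨h.trans hi, ?_, h'⟩
    have h0 : 0 ≤ e ⬝ᵥ (castVec (v i) - castVec (v i₀)) := by
      rcases hi₀ i with h2 | ⟨-, h2⟩
      · exact absurd h2 (by simp [h, hi])
      · rw [neg_dotProduct, neg_dotProduct] at h2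
        rw [dotProduct_sub]
        linarith
    have h1 : e ⬝ᵥ (castVec (v i) - castVec (v i₀)) ≤ e ⬝ᵥ β := by
      refine le_trans ?_ hle
      rw [hα, dotProduct_sub, dotProduct_sub]
      exact sub_le_sub_right h' _
    have h2 := hpar _ (hΔp i i₀) β (hΔq _ _) (by rw [dotProduct_sub, h, hi, sub_self]) huβ
    have h3 : castVec (v i) - castVec (v i₀) =
        ((e ⬝ᵥ (castVec (v i) - castVec (v i₀))) / (e ⬝ᵥ β)) • β := by
      rw [div_eq_inv_mul, mul_smul, h2, smul_smul, inv_mul_cancel₀ hβ0.ne', one_smul]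
    have h4 := (convex_convexHull ℝ _).add_smul_sub_mem (hqQ j₀) (hqQ j₁)
      ⟨div_nonneg h0 hβ0.le, (div_le_one hβ0).2 h1⟩
    rw [← hβ, ← h3] at h4
    simp only [Set.mem_ofPred_eq]
    convert h4 using 1
    abel
  let f : (Fin d → ℤ) → Fin d → ℤ := fun z => z + (w j₀ - v i₀)
  have hfeq : ∀ z, castVec (f z) = castVec z + (castVec (w j₀) - castVec (v i₀)) := fun z => by
    rw [castVec_add, castVec_sub]
  have huz : ∀ z ∈ faceLatticePoints P u, u ⬝ᵥ castVec z = u ⬝ᵥ castVec (v i₀) := fun z hz =>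
    le_antisymm (dotProduct_le_of_mem_convexHull (fun i => hi₀.le i) hz.1) (hz.2 _ (hpP i₀))
  have hsub : f '' faceLatticePoints P u ⊆ faceLatticePoints Q u := by
    rintro _ ⟨z, hz, rfl⟩
    have hz' := (hface _ hz.1 (huz z hz)).1
    refine ⟨by rwa [hfeq], fun y hy => (hQle y hy).trans_eq ?_⟩
    rw [hfeq, dotProduct_add, dotProduct_sub, huz z hz]
    ring
  have himg := Set.eq_of_subset_of_ncard_le hsub
    (by rw [Set.ncard_image_of_injective _ (add_left_injective _), hcard]) hfin
  have hmem : w j₁ ∈ faceLatticePoints Q u := ⟨hqQ j₁, fun y hy => (hQle y hy).trans_eq hj.symm⟩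
  rw [← himg] at hmem
  obtain ⟨z, hz, hzw⟩ := hmem
  have hz' := (hface _ hz.1 (huz z hz)).2
  have hzβ : β = castVec z - castVec (v i₀) := by
    rw [hβ, ← hzw, hfeq]
    abel
  have hge : e ⬝ᵥ β ≤ e ⬝ᵥ α := by
    rw [hzβ, hα, dotProduct_sub, dotProduct_sub]
    exact sub_le_sub_right hz' _
  have h5 := hpar α (hΔp _ _) β (hΔq _ _) huα huβ
  rw [le_antisymm hle hge] at h5
  exact (smul_right_injective _ hβ0.ne' h5).symm

theorem lexMax_sub_eq {d : ℕ} {ι κ : Type*} {u e : Fin d → ℝ} {v : ι → Fin d → ℤ}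
    {w : κ → Fin d → ℤ} {Δ : Set (Fin d → ℝ)}
    (hΔp : ∀ i j, castVec (v i) - castVec (v j) ∈ Δ)
    (hΔq : ∀ i j, castVec (w i) - castVec (w j) ∈ Δ)
    (hpar : ∀ a ∈ Δ, ∀ b ∈ Δ, u ⬝ᵥ a = 0 → u ⬝ᵥ b = 0 → (e ⬝ᵥ a) • b = (e ⬝ᵥ b) • a)
    (hne : ∀ a ∈ Δ, u ⬝ᵥ a = 0 → e ⬝ᵥ a = 0 → a = 0)
    (hfinp : (faceLatticePoints (convexHull ℝ (Set.range fun i => castVec (v i))) u).Finite)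
    (hfinq : (faceLatticePoints (convexHull ℝ (Set.range fun j => castVec (w j))) u).Finite)
    (hcard : (faceLatticePoints (convexHull ℝ (Set.range fun i => castVec (v i))) u).ncard =
      (faceLatticePoints (convexHull ℝ (Set.range fun j => castVec (w j))) u).ncard)
    {i₁ i₀ : ι} {j₁ j₀ : κ} (hi₁ : IsLexMax u e (fun i => castVec (v i)) i₁)
    (hi₀ : IsLexMax u (-e) (fun i => castVec (v i)) i₀)
    (hj₁ : IsLexMax u e (fun j => castVec (w j)) j₁)
    (hj₀ : IsLexMax u (-e) (fun j => castVec (w j)) j₀) :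
    castVec (v i₁) - castVec (v i₀) = castVec (w j₁) - castVec (w j₀) := by
  rcases le_total (e ⬝ᵥ (castVec (v i₁) - castVec (v i₀)))
    (e ⬝ᵥ (castVec (w j₁) - castVec (w j₀))) with h | h
  · exact lexMax_sub_eq_of_le hΔp hΔq hpar hne hfinq hcard hi₁ hi₀ hj₁ hj₀ h
  · exact (lexMax_sub_eq_of_le hΔq hΔp hpar hne hfinp hcard.symm hj₁ hj₀ hi₁ hi₀ h).symm

theorem isLocallyConstant_of_eventually_nhdsGT {X : Type*} {f : ℝ → X}
    (hr : ∀ s, ∀ᶠ t in nhdsWithin (0 : ℝ) (Set.Ioi 0), f (s + t) = f s)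
    (hl : ∀ s, ∀ᶠ t in nhdsWithin (0 : ℝ) (Set.Ioi 0), f (s - t) = f s) :
    IsLocallyConstant f := by
  rw [IsLocallyConstant.iff_eventually_eq]
  intro s
  obtain ⟨ε, hε, h⟩ := mem_nhdsGT_iff_exists_Ioo_subset.1 ((hr s).and (hl s))
  rw [Metric.eventually_nhds_iff]
  refine ⟨ε, hε, fun y hy => ?_⟩
  rw [Real.dist_eq, abs_lt] at hy
  rcases lt_trichotomy y s with hys | rfl | hys
  · simpa using (h ⟨sub_pos.2 hys, by linarith⟩).2
  · rfl
  · simpa using (h ⟨sub_pos.2 hys, by linarith⟩).1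

theorem exists_max_sub_eq.{r} {d : ℕ} {ι κ : Type r} [Finite ι] [Finite κ] [Nonempty ι] [Nonempty κ]
    {u e : Fin d → ℝ} {v : ι → Fin d → ℤ} {w : κ → Fin d → ℤ} {Δ : Set (Fin d → ℝ)}
    (hΔp : ∀ i j, castVec (v i) - castVec (v j) ∈ Δ)
    (hΔq : ∀ i j, castVec (w i) - castVec (w j) ∈ Δ)
    (hu : ∀ a ∈ Δ, u ⬝ᵥ a = 0 → a = 0)
    (he : ∀ a ∈ Δ, ∀ b ∈ Δ, e ⬝ᵥ ((u ⬝ᵥ a) • b - (u ⬝ᵥ b) • a) = 0 →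
      (u ⬝ᵥ a) • b - (u ⬝ᵥ b) • a = 0)
    (hcard : ∀ u : Fin d → ℝ,
      (faceLatticePoints (convexHull ℝ (Set.range fun i => castVec (v i))) u).ncard =
        (faceLatticePoints (convexHull ℝ (Set.range fun j => castVec (w j))) u).ncard)
    {i₀ : ι} {j₀ : κ} (hi₀ : ∀ i, u ⬝ᵥ castVec (v i) ≤ u ⬝ᵥ castVec (v i₀))
    (hj₀ : ∀ j, u ⬝ᵥ castVec (w j) ≤ u ⬝ᵥ castVec (w j₀)) :
    ∃ i₁ j₁, (∀ i, (u + e) ⬝ᵥ castVec (v i) ≤ (u + e) ⬝ᵥ castVec (v i₁)) ∧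
      (∀ j, (u + e) ⬝ᵥ castVec (w j) ≤ (u + e) ⬝ᵥ castVec (w j₁)) ∧
      castVec (v i₁) - castVec (w j₁) = castVec (v i₀) - castVec (w j₀) := by
  have hfin : ∀ {ι : Type r} [Finite ι] (v : ι → Fin d → ℤ) (u : Fin d → ℝ),
      (faceLatticePoints (convexHull ℝ (Set.range fun i => castVec (v i))) u).Finite :=
    fun v u => (finite_setOf_castVec_mem
      (((Set.finite_range _).isCompact_convexHull ℝ).isBounded)).subset fun z hz => hz.1
  have hne : ∀ s : ℝ, ∀ a ∈ Δ, (u + s • e) ⬝ᵥ a = 0 → e ⬝ᵥ a = 0 → a = 0 := by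
    intro s a ha h1 h2
    rw [add_dotProduct, smul_dotProduct, h2, smul_zero, add_zero] at h1
    exact hu a ha h1
  have hpar : ∀ s : ℝ, ∀ a ∈ Δ, ∀ b ∈ Δ, (u + s • e) ⬝ᵥ a = 0 → (u + s • e) ⬝ᵥ b = 0 →
      (e ⬝ᵥ a) • b = (e ⬝ᵥ b) • a := by
    intro s a ha b hb h1 h2
    rw [add_dotProduct, smul_dotProduct, smul_eq_mul] at h1 h2
    by_cases hs : s = 0
    · rw [hu a ha (by simpa [hs] using h1), hu b hb (by simpa [hs] using h2)]
    have h3 : u ⬝ᵥ a = -s * (e ⬝ᵥ a) := by linarith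
    have h4 : u ⬝ᵥ b = -s * (e ⬝ᵥ b) := by linarith
    have h5 := he a ha b hb (by
      rw [dotProduct_sub, dotProduct_smul, dotProduct_smul, h3, h4, smul_eq_mul, smul_eq_mul]
      ring)
    rw [h3, h4, mul_smul, mul_smul, ← smul_sub, smul_eq_zero] at h5
    exact sub_eq_zero.1 (h5.resolve_left (neg_ne_zero.2 hs))
  choose i₁ hi₁ using fun s : ℝ => exists_isLexMax (u + s • e) e fun i => castVec (v i)
  choose i₂ hi₂ using fun s : ℝ => exists_isLexMax (u + s • e) (-e) fun i => castVec (v i)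
  choose j₁ hj₁ using fun s : ℝ => exists_isLexMax (u + s • e) e fun j => castVec (w j)
  choose j₂ hj₂ using fun s : ℝ => exists_isLexMax (u + s • e) (-e) fun j => castVec (w j)
  have hD : ∀ s, castVec (v (i₁ s)) - castVec (w (j₁ s)) =
      castVec (v (i₂ s)) - castVec (w (j₂ s)) := by
    intro s
    have := lexMax_sub_eq hΔp hΔq (hpar s) (hne s) (hfin v _) (hfin w _) (hcard _) (hi₁ s) (hi₂ s)
      (hj₁ s) (hj₂ s)
    rw [sub_eq_sub_iff_add_eq_add] at this ⊢
    rw [this, add_comm]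
  have hinj : ∀ {ι : Type r} (v : ι → Fin d → ℤ), (∀ i j, castVec (v i) - castVec (v j) ∈ Δ) →
      ∀ (s : ℝ) (i j : ι), (u + s • e) ⬝ᵥ castVec (v j) = (u + s • e) ⬝ᵥ castVec (v i) →
        e ⬝ᵥ castVec (v j) = e ⬝ᵥ castVec (v i) → castVec (v j) = castVec (v i) := by
    intro ι v hv s i j h1 h2
    refine sub_eq_zero.1 (hne s _ (hv j i) ?_ ?_)
    · rw [dotProduct_sub, h1, sub_self]
    · rw [dotProduct_sub, h2, sub_self]
  have hright : ∀ {ι : Type r} [Finite ι] (v : ι → Fin d → ℤ),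
      (∀ i j, castVec (v i) - castVec (v j) ∈ Δ) → ∀ (i₁ : ℝ → ι),
      (∀ s, IsLexMax (u + s • e) e (fun i => castVec (v i)) (i₁ s)) →
      ∀ s, ∀ᶠ t in nhdsWithin (0 : ℝ) (Set.Ioi 0),
        castVec (v (i₁ (s + t))) = castVec (v (i₁ s)) := by
    intro ι _ v hv i₁ hi₁ s
    filter_upwards [(hi₁ s).eventually fun j => hinj v hv s _ j] with t ht
    refine (ht _).resolve_right (not_lt.2 ?_)
    have := (hi₁ (s + t)).le (i₁ s)
    rwa [add_smul, ← add_assoc] at this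
  have hleft : ∀ {ι : Type r} [Finite ι] (v : ι → Fin d → ℤ),
      (∀ i j, castVec (v i) - castVec (v j) ∈ Δ) → ∀ (i₁ i₂ : ℝ → ι),
      (∀ s, IsLexMax (u + s • e) e (fun i => castVec (v i)) (i₁ s)) →
      (∀ s, IsLexMax (u + s • e) (-e) (fun i => castVec (v i)) (i₂ s)) →
      ∀ s, ∀ᶠ t in nhdsWithin (0 : ℝ) (Set.Ioi 0),
        castVec (v (i₁ (s - t))) = castVec (v (i₂ s)) := by
    intro ι _ v hv i₁ i₂ hi₁ hi₂ s
    filter_upwards [(hi₂ s).eventually fun j h1 h2 =>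
      hinj v hv s _ j h1 (by simpa using h2)] with t ht
    refine (ht _).resolve_right (not_lt.2 ?_)
    have := (hi₁ (s - t)).le (i₂ s)
    rwa [sub_smul, ← add_sub_assoc, sub_eq_add_neg, ← smul_neg] at this
  have hconst : IsLocallyConstant fun s : ℝ => castVec (v (i₁ s)) - castVec (w (j₁ s)) := by
    refine isLocallyConstant_of_eventually_nhdsGT (fun s => ?_) fun s => ?_
    · filter_upwards [hright v hΔp i₁ hi₁ s, hright w hΔq j₁ hj₁ s] with t h1 h2
      rw [h1, h2]
    · filter_upwards [hleft v hΔp i₁ i₂ hi₁ hi₂ s, hleft w hΔq j₁ j₂ hj₁ hj₂ s] with t h1 h2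
      rw [h1, h2, hD]
  have huniq : ∀ {ι : Type r} (v : ι → Fin d → ℤ), (∀ i j, castVec (v i) - castVec (v j) ∈ Δ) →
      ∀ i i₀, IsLexMax (u + (0 : ℝ) • e) e (fun i => castVec (v i)) i →
        (∀ i, u ⬝ᵥ castVec (v i) ≤ u ⬝ᵥ castVec (v i₀)) → castVec (v i) = castVec (v i₀) := by
    intro ι v hv i i₀ hi hi₀
    refine sub_eq_zero.1 (hu _ (hv i i₀) ?_)
    have := hi.le i₀
    rw [zero_smul, add_zero] at this
    rw [dotProduct_sub, (hi₀ i).antisymm this, sub_self]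
  refine ⟨i₁ 1, j₁ 1, fun i => ?_, fun j => ?_, ?_⟩
  · simpa using (hi₁ 1).le i
  · simpa using (hj₁ 1).le j
  · rw [← huniq v hΔp _ i₀ (hi₁ 0) hi₀, ← huniq w hΔq _ j₀ (hj₁ 0) hj₀]
    exact hconst.apply_eq_of_preconnectedSpace 1 0

theorem convexHull_subset_vadd_of_dense {d : ℕ} {ι κ : Type*} [Finite κ]
    {u D : Fin d → ℝ} {p : ι → Fin d → ℝ} {q : κ → Fin d → ℝ}
    (h : Dense {e | ∃ i₁ j₁, (∀ i, (u + e) ⬝ᵥ p i ≤ (u + e) ⬝ᵥ p i₁) ∧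
      (∀ j, (u + e) ⬝ᵥ q j ≤ (u + e) ⬝ᵥ q j₁) ∧ p i₁ - q j₁ = D}) :
    convexHull ℝ (Set.range p) ⊆ D +ᵥ convexHull ℝ (Set.range q) := by
  refine convexHull_min ?_ ((convex_convexHull ℝ _).vadd _)
  rintro _ ⟨i, rfl⟩
  by_contra hi
  obtain ⟨f, c, hf, hc⟩ := geometric_hahn_banach_closed_point ((convex_convexHull ℝ _).vadd D)
    (((Set.finite_range q).isCompact_convexHull ℝ).vadd D).isClosed hi
  set a : Fin d → ℝ := fun k => f fun l => if k = l then 1 else 0 with ha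
  have hfa : ∀ x, f x = a ⬝ᵥ x := by
    intro x
    rw [← ContinuousLinearMap.coe_coe, LinearMap.pi_apply_eq_sum_univ f.toLinearMap x, dotProduct]
    exact Finset.sum_congr rfl fun k _ => mul_comm _ _
  have hopen : IsOpen {e | ∀ j, (u + e) ⬝ᵥ (D + q j) < (u + e) ⬝ᵥ p i} := by
    rw [Set.ofPred_forall]
    refine isOpen_iInter_of_finite fun j => isOpen_lt ?_ ?_
    · exact (continuous_dotProduct_left _).comp (by fun_prop)
    · exact (continuous_dotProduct_left _).comp (by fun_prop)
  obtain ⟨e, he, i₁, j₁, hi₁, hj₁, hD⟩ := h.inter_open_nonempty _ hopen ⟨a - u, fun j => by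
    rw [add_sub_cancel, ← hfa, ← hfa]
    exact (hf _ ⟨q j, subset_convexHull ℝ _ ⟨j, rfl⟩, rfl⟩).trans hc⟩
  refine (he j₁).not_ge ?_
  rw [← hD, sub_add_cancel]
  exact hi₁ i

theorem exists_eq_vadd_of_ncard_faceLatticePoints_eq {d n m : ℕ} (hn : 0 < n) (hm : 0 < m)
    {v : Fin n → Fin d → ℤ} {w : Fin m → Fin d → ℤ}
    (hcard : ∀ u : Fin d → ℝ,
      (faceLatticePoints (convexHull ℝ (Set.range fun i => castVec (v i))) u).ncard =
        (faceLatticePoints (convexHull ℝ (Set.range fun j => castVec (w j))) u).ncard) :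
    ∃ D : Fin d → ℝ, convexHull ℝ (Set.range fun i => castVec (v i)) =
      D +ᵥ convexHull ℝ (Set.range fun j => castVec (w j)) := by
  have : Nonempty (Fin n) := ⟨⟨0, hn⟩⟩
  have : Nonempty (Fin m) := ⟨⟨0, hm⟩⟩
  set Δ : Set (Fin d → ℝ) := Set.range (fun k : Fin n × Fin n => castVec (v k.1) - castVec (v k.2)) ∪
    Set.range (fun k : Fin m × Fin m => castVec (w k.1) - castVec (w k.2)) with hΔ
  have hΔfin : Δ.Finite := (Set.finite_range _).union (Set.finite_range _)
  have hΔp : ∀ i j, castVec (v i) - castVec (v j) ∈ Δ := fun i j => Or.inl ⟨(i, j), rfl⟩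
  have hΔq : ∀ i j, castVec (w i) - castVec (w j) ∈ Δ := fun i j => Or.inr ⟨(i, j), rfl⟩
  obtain ⟨u, hu⟩ := (dense_setOf_forall_dotProduct_ne_zero hΔfin.countable).nonempty
  have hΓ : (Set.image2 (fun a b => (u ⬝ᵥ a) • b - (u ⬝ᵥ b) • a) Δ Δ).Countable :=
    hΔfin.countable.image2 hΔfin.countable _
  obtain ⟨i₀, hi₀⟩ := exists_isLexMax u 0 fun i => castVec (v i)
  obtain ⟨j₀, hj₀⟩ := exists_isLexMax u 0 fun j => castVec (w j)
  have key : Dense {e : Fin d → ℝ | ∃ i₁ j₁,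
      (∀ i, (u + e) ⬝ᵥ castVec (v i) ≤ (u + e) ⬝ᵥ castVec (v i₁)) ∧
      (∀ j, (u + e) ⬝ᵥ castVec (w j) ≤ (u + e) ⬝ᵥ castVec (w j₁)) ∧
      castVec (v i₁) - castVec (w j₁) = castVec (v i₀) - castVec (w j₀)} := by
    refine (dense_setOf_forall_dotProduct_ne_zero hΓ).mono fun e he => ?_
    exact exists_max_sub_eq hΔp hΔq hu
      (fun a ha b hb => he _ (Set.mem_image2_of_mem ha hb)) hcard hi₀.le hj₀.le
  refine ⟨castVec (v i₀) - castVec (w j₀),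
    (convexHull_subset_vadd_of_dense key).antisymm ?_⟩
  rw [Set.vadd_set_subset_iff_subset_neg_vadd_set]
  refine convexHull_subset_vadd_of_dense (u := u) (key.mono ?_)
  rintro e ⟨i₁, j₁, h1, h2, h3⟩
  exact ⟨j₁, i₁, h2, h1, by rw [← h3, neg_sub]⟩

theorem denv_pos {d : ℕ} (c : Fin d → ℚ) : 0 < denv c :=
  Nat.pos_of_ne_zero (Finset.lcm_ne_zero_iff.2 fun i _ => (c i).den_nz)

theorem exists_castVec_eq_smul_ratVec {d : ℕ} (c : Fin d → ℚ) {k : ℤ} (hk : (denv c : ℤ) ∣ k) :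
    ∃ a : Fin d → ℤ, castVec a = (k : ℝ) • ratVec c := by
  have h : ∀ i, ∃ a : ℤ, (a : ℝ) = k * c i := by
    intro i
    obtain ⟨m, hm⟩ := (Int.natCast_dvd_natCast.2
      (Finset.dvd_lcm (f := fun i => (c i).den) (Finset.mem_univ i))).trans hk
    refine ⟨m * (c i).num, ?_⟩
    have h : ((c i).den : ℝ) * c i = (c i).num := by exact_mod_cast Rat.den_mul_eq_num (c i)
    rw [hm]
    push_cast
    linear_combination (-(m : ℝ)) * h
  choose a ha using h
  exact ⟨a, funext fun i => ha i⟩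

/-- The dilates of `P` translated by integer multiples of a rational vector `c` have lattice point
counts depending only on the multiple modulo `denv c`. -/
theorem latCount_smul_ratVec_vadd_congr {d : ℕ} (c : Fin d → ℚ) (S : Set (Fin d → ℝ)) {k l : ℤ}
    (h : (denv c : ℤ) ∣ k - l) :
    latCount ((k : ℝ) • ratVec c +ᵥ S) = latCount ((l : ℝ) • ratVec c +ᵥ S) := by
  obtain ⟨a, ha⟩ := exists_castVec_eq_smul_ratVec c h
  rw [← latCount_castVec_vadd a ((l : ℝ) • ratVec c +ᵥ S), ha, vadd_vadd, ← add_smul]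
  push_cast
  rw [sub_add_cancel]

theorem smul_vadd_set_eq {d : ℕ} (r : ℝ) (x : Fin d → ℝ) (S : Set (Fin d → ℝ)) :
    r • (x +ᵥ S) = (r • x) +ᵥ r • S := by
  simp only [← Set.image_smul, ← Set.image_vadd, Set.image_image, vadd_eq_add, smul_add]

theorem ehr_eq_latCount {d : ℕ} (P : Set (Fin d → ℝ)) (c : Fin d → ℚ) (t : ℕ) :
    ehr P c t = latCount (((t : ℤ) : ℝ) • ratVec c +ᵥ (t : ℝ) • P) := by
  rw [ehr, smul_vadd_set_eq, Int.cast_natCast]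

theorem latCount_neg_vadd {d : ℕ} (x : Fin d → ℝ) (S : Set (Fin d → ℝ)) :
    latCount (-x +ᵥ S) = latCount (x +ᵥ -S) := by
  rw [← latCount_neg]
  congr 1
  ext y
  simp only [Set.mem_neg, Set.mem_vadd_set_iff_neg_vadd_mem, vadd_eq_add, neg_add, neg_neg]

theorem polynomial_eq_of_forall_eval_add_mul {p q : Polynomial ℚ} (a : ℕ) {ρ : ℕ} (hρ : 0 < ρ)
    (h : ∀ m : ℕ, p.eval ((a + ρ * (m + 1) : ℕ) : ℚ) = q.eval ((a + ρ * (m + 1) : ℕ) : ℚ)) :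
    p = q := by
  refine Polynomial.eq_of_infinite_eval_eq p q ((Set.infinite_range_of_injective
    (f := fun m : ℕ => ((a + ρ * (m + 1) : ℕ) : ℚ)) fun m n hmn => ?_).mono ?_)
  · have := Nat.cast_injective hmn
    simpa [hρ.ne'] using this
  · rintro _ ⟨m, rfl⟩
    exact h m

theorem IsLatticePolytope.isCompact {d : ℕ} {P : Set (Fin d → ℝ)} (hP : IsLatticePolytope P) :
    IsCompact P := by
  obtain ⟨n, -, v, rfl⟩ := hP.exists_range
  exact (Set.finite_range _).isCompact_convexHull ℝ

theorem IsLatticePolytope.convex {d : ℕ} {P : Set (Fin d → ℝ)} (hP : IsLatticePolytope P) :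
    Convex ℝ P := by
  obtain ⟨n, -, v, rfl⟩ := hP.exists_range
  exact convex_convexHull ℝ _

theorem IsLatticePolytope.neg {d : ℕ} {P : Set (Fin d → ℝ)} (hP : IsLatticePolytope P) :
    IsLatticePolytope (-P) := by
  classical
  obtain ⟨V, hV, rfl⟩ := hP
  refine ⟨V.image Neg.neg, hV.image _, ?_⟩
  rw [← convexHull_neg, Finset.coe_image, Set.image_image]
  simp_rw [castVec_neg]
  rw [← Set.image_image Neg.neg castVec, Set.image_neg_eq_neg]

theorem IsLatticePolytope.exists_castVec_eq_of_eq_vadd_neg {d : ℕ} {P : Set (Fin d → ℝ)}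
    (hP : IsLatticePolytope P) {v : Fin d → ℝ} (hv : P = v +ᵥ -P) :
    ∃ a : Fin d → ℤ, castVec a = v := by
  have hmem : ∀ x ∈ P, v - x ∈ P := by
    intro x hx
    rw [hv]
    exact ⟨-x, by simpa using hx, by simp [sub_eq_add_neg]⟩
  have hext : ∀ x ∈ Set.extremePoints ℝ P, ∃ a : Fin d → ℤ, castVec a = x := by
    obtain ⟨V, -, hV⟩ := hP
    intro x hx
    rw [hV] at hx
    obtain ⟨a, -, ha⟩ := extremePoints_convexHull_subset hx
    exact ⟨a, ha⟩
  have hne : P.Nonempty := by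
    obtain ⟨V, hV, rfl⟩ := hP
    exact (hV.to_set.image _).convexHull
  obtain ⟨e, he⟩ := hP.isCompact.extremePoints_nonempty hne
  have he' : v - e ∈ Set.extremePoints ℝ P := by
    rw [mem_extremePoints] at he ⊢
    refine ⟨hmem e he.1, fun x hx y hy hxy => ?_⟩
    have h := he.2 _ (hmem x hx) _ (hmem y hy) ?_
    · exact ⟨by rw [← h.1, sub_sub_cancel], by rw [← h.2, sub_sub_cancel]⟩
    · obtain ⟨a, b, ha, hb, hab, h⟩ := hxy
      refine ⟨a, b, ha, hb, hab, ?_⟩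
      rw [smul_sub, smul_sub, sub_add_sub_comm, h, ← add_smul, hab, one_smul, sub_sub_cancel]
  obtain ⟨a, ha⟩ := hext _ he
  obtain ⟨b, hb⟩ := hext _ he'
  exact ⟨a + b, by rw [castVec_add, ha, hb, add_sub_cancel]⟩

theorem IsLatticePolytope.exists_eq_vadd {d : ℕ} {P Q : Set (Fin d → ℝ)} (hP : IsLatticePolytope P)
    (hQ : IsLatticePolytope Q)
    (h : ∀ c : Fin d → ℚ, latCount (ratVec c +ᵥ P) = latCount (ratVec c +ᵥ Q)) :
    ∃ D : Fin d → ℝ, P = D +ᵥ Q := by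
  have hcard := ncard_faceLatticePoints_eq hP.isCompact hP.convex hQ.isCompact hQ.convex
    (latCount_vadd_eq_of_ratVec hP hQ h)
  obtain ⟨n, hn, v, rfl⟩ := hP.exists_range
  obtain ⟨m, hm, w, rfl⟩ := hQ.exists_range
  exact exists_eq_vadd_of_ncard_faceLatticePoints_eq hn hm hcard

/-- A lattice polytope `P` is centrally symmetric iff for every
`c ∈ ℚ^d` the Ehrhart quasi-polynomial `L_{c+P}` is symmetric with respect to the
period `den(c)`. -/
theorem centrally_symmetric_iff_symmetric_ehrhart
    (d : ℕ) (P : Set (Fin d → ℝ)) (hP : IsLatticePolytope P) :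
    CentrallySymmetric P ↔ ∀ c : Fin d → ℚ, SymmetricQP (ehr P c) (denv c) := by
  have hρ := fun c : Fin d → ℚ => denv_pos c
  choose p hp using fun (c : Fin d → ℚ) (k : ℤ) =>
    hP.exists_polynomial_latCount ((k : ℝ) • ratVec c)
  constructor
  · rintro ⟨v, hv⟩ c f hf
    obtain ⟨a, rfl⟩ := hP.exists_castVec_eq_of_eq_vadd_neg hv
    have hfp : ∀ k : ℕ, f (k % denv c) = p c k := by
      intro k
      refine polynomial_eq_of_forall_eval_add_mul k (hρ c) fun m => ?_
      have h := hf (k + denv c * (m + 1))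
        (Nat.add_pos_right _ (Nat.mul_pos (hρ c) m.succ_pos))
      rw [Nat.add_mul_mod_self_left] at h
      rw [← h, ← hp, ehr_eq_latCount, latCount_smul_ratVec_vadd_congr c _ (l := k)]
      push_cast
      rw [add_sub_cancel_left]
      exact dvd_mul_right _ _
    intro k hk
    rw [hfp, hfp]
    refine polynomial_eq_of_forall_eval_add_mul 0 one_pos fun m => ?_
    generalize 0 + 1 * (m + 1) = t
    rw [← hp, ← hp, latCount_smul_ratVec_vadd_congr c _ (k := ((denv c - k : ℕ) : ℤ)) (l := -k)
      (by rw [Nat.cast_sub hk]; simp)]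
    rw [Int.cast_neg, neg_smul, latCount_neg_vadd, ← Set.smul_set_neg,
      
      ← latCount_castVec_vadd (t • a) ((((k : ℤ) : ℝ) • ratVec c) +ᵥ (t : ℝ) • -P), vadd_comm]
    congr 3
    conv_lhs => rw [hv]
    have : castVec (t • a) = (t : ℝ) • castVec a := by
      ext i
      simp [castVec]
    rw [smul_vadd_set_eq, this]
  · intro h
    refine hP.exists_eq_vadd hP.neg fun c => ?_
    have hf : IsConstituents (ehr P c) (denv c) fun k => p c k := by
      intro t _
      rw [ehr_eq_latCount, ← hp, latCount_smul_ratVec_vadd_congr c]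
      push_cast
      exact Int.dvd_self_sub_emod
    have h1 := congrArg (Polynomial.eval ((1 : ℕ) : ℚ)) (h c _ hf 1 (hρ c))
    rw [← hp, ← hp, latCount_smul_ratVec_vadd_congr c _ (l := 1),
      latCount_smul_ratVec_vadd_congr c _ (k := (((denv c - 1) % denv c : ℕ) : ℤ)) (l := -1)] at h1
    · rw [← latCount_neg_vadd]
      simpa using h1
    · rw [Nat.mod_eq_of_lt (Nat.sub_lt (hρ c) one_pos), Nat.cast_pred (hρ c)]
      simp
    · rw [dvd_sub_comm]
      push_cast
      exact Int.dvd_self_sub_emod
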